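/- For all positive integers n and s, one has ĝ(n,s) ≥ max{s, √(2ns) − 3s/2}. -/

import Mathlib

namespace AltitudePaper

/-- The contents of one column after its ungrounded tokens each shift down one cell.
A column is a set of occupied rows; its grounded tokens are the initial segment
`[0, sInf Tᶜ)`, which stay put, and every ungrounded token moves down one row. -/
def shiftDown (T : Set ℕ) : Set ℕ :=
  {i | i ∈ T ∧ i < sInf Tᶜ} ∪ {i | sInf Tᶜ ≤ i ∧ i + 1 ∈ T}

/-- A token game (together with a play of it).  `board t` is the array `B_t` (for
`0 ≤ t ≤ len`): each column (indexed by `Fin n`) is the set of rows occupied by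
tokens.  `active t` is the active column at step `t`, advancing cyclically.  `move t`
records the player's optional move at step `t`: `some (v, i, i')` means the highest
grounded token of the active column, in row `i`, is moved to the empty cell in
row `i' ≤ i` of column `v` (allowed only if no earlier step moved a token between
these two columns); afterwards the ungrounded tokens of the active column shift down
one cell. -/
structure TokenGame (n : ℕ) where
  /-- number of steps -/
  len : ℕ
  /-- the array after `t` steps: each column is the set of rows occupied by tokens -/
  board : ℕ → Fin n → Set ℕ
  /-- the active column at each step -/
  active : ℕ → Fin n
  /-- the optional move at each step: target column, source row, target row -/
  move : ℕ → Option (Fin n × ℕ × ℕ)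
  /-- the active column advances cyclically -/
  active_succ : ∀ t, (active (t + 1)).val = ((active t).val + 1) % n
  /-- a step with no token moved: the ungrounded tokens of the active column shift
  down one cell -/
  step_none : ∀ t < len, move t = none →
    ∀ w, board (t + 1) w =
      if w = active t then shiftDown (board t (active t)) else board t w
  /-- a step moving a token: the token moved is the highest grounded token of the
  active column, it moves to an empty cell in a weakly lower row of another column,
  no earlier step moved a token between these two columns, and then the ungrounded
  tokens of the active column shift down one cell -/
  step_some : ∀ t < len, ∀ v i i', move t = some (v, i, i') →
    v ≠ active t ∧
    (∀ j ≤ i, j ∈ board t (active t)) ∧ i + 1 ∉ board t (active t) ∧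
    i' ≤ i ∧ i' ∉ board t v ∧
    (∀ t' < t, ∀ v' i₀ i₀', move t' = some (v', i₀, i₀') →
      ¬((active t' = active t ∧ v' = v) ∨ (active t' = v ∧ v' = active t))) ∧
    (∀ w, board (t + 1) w =
      if w = active t then shiftDown (board t (active t) \ {i})
      else if w = v then insert i' (board t v) else board t w)

/-- The number of transfer steps (steps moving a token between two columns) of a
token game. -/
def transferCount {n : ℕ} (g : TokenGame n) : ℕ :=
  ((Finset.range g.len).filter fun t => (g.move t).isSome).card

/-- The number of transfer steps among steps `t₁ ≤ t < t₂` of a token game;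
these are the transfer steps of the subgame with transcript `B_{t₁}, …, B_{t₂}`. -/
def transferCountBetween {n : ℕ} (g : TokenGame n) (t₁ t₂ : ℕ) : ℕ :=
  ((Finset.Ico t₁ t₂).filter fun t => (g.move t).isSome).card

/-- `ĝ(n, s)`: the maximum number of tokens that can be placed in a single column in
an `(n,s)`-token game (a token game with `n` columns, each initially containing at
most `s` tokens). -/
noncomputable def ghat (n s : ℕ) : ℕ :=
  sSup {k | ∃ g : TokenGame n, (∀ u, (g.board 0 u).Finite) ∧
    (∀ u, (g.board 0 u).ncard ≤ s) ∧ ∃ t ≤ g.len, ∃ u, k = (g.board t u).ncard}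



lemma shiftDown_subset_image (T : Set ℕ) :
    shiftDown T ⊆ (fun i => if i < sInf Tᶜ then i else i - 1) '' T := by
  rintro i (⟨h1, h2⟩ | ⟨h1, h2⟩)
  · exact ⟨i, h1, by simp [h2]⟩
  · refine ⟨i + 1, h2, ?_⟩
    have : ¬ (i + 1 < sInf Tᶜ) := by omega
    simp [this]

lemma shiftDown_finite {T : Set ℕ} (h : T.Finite) : (shiftDown T).Finite :=
  (h.image _).subset (shiftDown_subset_image T)

lemma shiftDown_ncard {T : Set ℕ} (h : T.Finite) : (shiftDown T).ncard ≤ T.ncard :=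
  (Set.ncard_le_ncard (shiftDown_subset_image T) (h.image _)).trans (Set.ncard_image_le h)

/-- tokens are never created -/
lemma game_bound {n : ℕ} (g : TokenGame n) (s : ℕ) (hf : ∀ u, (g.board 0 u).Finite)
    (hs : ∀ u, (g.board 0 u).ncard ≤ s) :
    ∀ t ≤ g.len, (∀ u, (g.board t u).Finite) ∧ ∑ u, (g.board t u).ncard ≤ n * s := by
  intro t
  induction t with
  | zero =>
    intro _
    refine ⟨hf, ?_⟩
    calc ∑ u, (g.board 0 u).ncard ≤ ∑ _u : Fin n, s := Finset.sum_le_sum fun u _ => hs u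
      _ = n * s := by simp
  | succ t ih =>
    intro ht
    obtain ⟨ihf, ihs⟩ := ih (by omega)
    rcases hm : g.move t with _ | ⟨v, i, i'⟩
    · have hb := g.step_none t (by omega) hm
      constructor
      · intro u
        rw [hb]
        split_ifs
        · exact shiftDown_finite (ihf _)
        · exact ihf _
      · refine le_trans (Finset.sum_le_sum fun u _ => ?_) ihs
        rw [hb]
        split_ifs with h
        · subst h; exact shiftDown_ncard (ihf _)
        · exact le_rfl
    · obtain ⟨hv, hgr, -, -, hi', -, hb⟩ := g.step_some t (by omega) v i i' hm
      constructor
      · intro u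
        rw [hb]
        split_ifs
        · exact shiftDown_finite ((ihf _).subset Set.sdiff_subset)
        · exact (ihf _).insert _
        · exact ihf _
      · have key : ∀ u, (g.board (t + 1) u).ncard + (if u = g.active t then 1 else 0)
            ≤ (g.board t u).ncard + (if u = v then 1 else 0) := by
          intro u
          rw [hb]
          by_cases h : u = g.active t
          · subst h
            have h1 := shiftDown_ncard ((ihf (g.active t)).subset
              (Set.sdiff_subset (s := g.board t (g.active t)) (t := {i})))
            have h2 := Set.ncard_sdiff_singleton_add_one (hgr i le_rfl) (ihf _)
            simp only [if_true, hv.symm, if_false]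
            omega
          · by_cases h' : u = v
            · subst h'
              simp only [h, if_false, if_true]
              rw [Set.ncard_insert_of_notMem hi' (ihf _)]
            · simp [h, h']
        have := Finset.sum_le_sum (s := Finset.univ) fun u _ => key u
        rw [Finset.sum_add_distrib, Finset.sum_add_distrib] at this
        simp at this
        omega

lemma le_ghat {n s : ℕ} (g : TokenGame n) (hf : ∀ u, (g.board 0 u).Finite)
    (hs : ∀ u, (g.board 0 u).ncard ≤ s) (t : ℕ) (ht : t ≤ g.len) (u : Fin n) :
    (g.board t u).ncard ≤ ghat n s := by
  refine le_csSup ⟨n * s, ?_⟩ ⟨g, hf, hs, t, ht, u, rfl⟩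
  rintro k ⟨g, hf, hs, t, ht, u, rfl⟩
  exact (Finset.single_le_sum (f := fun u => (g.board t u).ncard) (fun _ _ => Nat.zero_le _)
    (Finset.mem_univ u)).trans (game_bound g s hf hs t ht).2

lemma shiftDown_Ico_zero (h : ℕ) : shiftDown (Set.Ico 0 h) = Set.Ico 0 h := by
  have : sInf (Set.Ico 0 h)ᶜ = h := by
    apply le_antisymm
    · exact Nat.sInf_le (by simp)
    · exact le_csInf ⟨h, by simp⟩ (fun b hb => by simpa using hb)
  ext i
  simp only [shiftDown, this, Set.mem_union, Set.mem_ofPred_eq, Set.mem_Ico]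
  omega

lemma shiftDown_Ico_pos (l h : ℕ) (hl : 0 < l) :
    shiftDown (Set.Ico l h) = Set.Ico (l - 1) (h - 1) := by
  have : sInf (Set.Ico l h)ᶜ = 0 := by
    apply Nat.eq_zero_of_le_zero
    exact Nat.sInf_le (by simp; omega)
  ext i
  simp only [shiftDown, this, Set.mem_union, Set.mem_ofPred_eq, Set.mem_Ico]
  omega

/-- first column of stage `k` -/
def stageStart (s : ℕ) : ℕ → ℕ
  | 0 => 0
  | k + 1 => stageStart s k + s * (k + 1)

lemma stageStart_mono (s : ℕ) : Monotone (stageStart s) :=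
  monotone_nat_of_le_succ fun k => by simp [stageStart]

lemma le_stageStart (s : ℕ) (hs : 1 ≤ s) (k : ℕ) : k ≤ stageStart s k := by
  induction k with
  | zero => simp
  | succ k ih =>
    have : 1 ≤ s * (k + 1) := Nat.mul_pos hs (by omega)
    simp only [stageStart]; omega

lemma two_stageStart (s k : ℕ) : 2 * stageStart s k = s * (k * (k + 1)) := by
  induction k with
  | zero => simp [stageStart]
  | succ k ih => simp only [stageStart, mul_add, ih]; ring

lemma exists_stage (s : ℕ) (hs : 1 ≤ s) (c : ℕ) :
    ∃ k, stageStart s k ≤ c ∧ c < stageStart s (k + 1) := by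
  have hex : ∃ k, c < stageStart s (k + 1) := ⟨c, le_stageStart s hs (c + 1)⟩
  classical
  refine ⟨Nat.find hex, ?_, Nat.find_spec hex⟩
  rcases h : Nat.find hex with _ | k
  · simp [stageStart]
  · have := Nat.find_min hex (m := k) (by omega)
    omega

/-- Data of the construction: for each column, the first column of its stage (`b`), of the
next stage (`nb`) and of the previous stage (`pb`). -/
lemma exists_data (s : ℕ) (hs : 1 ≤ s) : ∃ b nb pb : ℕ → ℕ,
    (∀ c, b c ≤ c) ∧ (∀ c, c < nb c) ∧ (∀ c, pb c ≤ b c) ∧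
    (∀ c, nb c + pb c = 2 * b c + s) ∧
    (∀ a r, pb r ≤ a → a < b r → nb a = b r) ∧
    (∀ a r, nb a ≤ r → r + a < 2 * nb a → b r = nb a ∧ pb r ≤ a) ∧
    (∀ k, nb (stageStart s k) = stageStart s (k + 1)) := by
  choose st h1 h2 using exists_stage s hs
  have uniq : ∀ c k, stageStart s k ≤ c → c < stageStart s (k + 1) → st c = k := by
    intro c k hk hk'
    apply le_antisymm
    · by_contra h
      have := stageStart_mono s (show k + 1 ≤ st c by omega)
      have := h1 c
      omega
    · by_contra h
      have := stageStart_mono s (show st c + 1 ≤ k by omega)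
      have := h2 c
      omega
  have hstep : ∀ k, stageStart s (k + 1) + stageStart s (k - 1) = 2 * stageStart s k + s := by
    intro k
    rcases k with _ | k
    · simp [stageStart]
    · simp only [stageStart, Nat.add_sub_cancel]; ring
  refine ⟨fun c => stageStart s (st c), fun c => stageStart s (st c + 1),
    fun c => stageStart s (st c - 1), h1, h2, fun c => stageStart_mono s (by omega),
    fun c => hstep _, ?_, ?_, ?_⟩
  · intro a r ha ha'
    simp only at *
    have hne : st r ≠ 0 := by
      intro h; rw [h] at ha'; simp [stageStart] at ha'
    have e : st r - 1 + 1 = st r := by omega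
    rw [uniq a (st r - 1) ha (by rw [e]; exact ha'), e]
  · intro a r har har'
    simp only at *
    have := hstep (st a + 1)
    simp only [Nat.add_sub_cancel] at this
    have := h1 a
    rw [uniq r (st a + 1) har (by omega)]
    simp [this]
  · intro k
    have : 0 < s * (k + 1) := Nat.mul_pos hs (by omega)
    simp only
    rw [uniq (stageStart s k) k le_rfl (by simp only [stageStart]; omega)]

/-- lowest token -/
def lo (b pb : ℕ → ℕ) (r a c : ℕ) : ℕ :=
  if r < c then (2 * b c - pb c - c) + (c - r - if c < a then 1 else 0)
  else if r = c then min (2 * b c - pb c - c) (2 * b c - c - a) else 0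

/-- one above the highest token -/
def hi (nb : ℕ → ℕ) (r a c : ℕ) : ℕ :=
  if r < c then (nb c - c) + (c - r - if c < a then 1 else 0)
  else (nb c - c) - ((r + if c < a then 1 else 0) - nb c)

lemma main_bound (n s : ℕ) (hn : 1 ≤ n) (hs : 1 ≤ s) (k : ℕ) (hk : stageStart s k < n) :
    s * (k + 1) ≤ ghat n s := by
  obtain ⟨b, nb, pb, hb, hnb, hpb, hsum, hd1, hd2, hst⟩ := exists_data s hs
  have hdiv : ∀ t, (t % n + 1 < n ∧ (t + 1) / n = t / n ∧ (t + 1) % n = t % n + 1) ∨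
      (t % n + 1 = n ∧ (t + 1) / n = t / n + 1 ∧ (t + 1) % n = 0) := by
    intro t
    have h1 := Nat.div_add_mod t n
    have h2 := Nat.mod_lt t hn
    by_cases h : t % n + 1 < n
    · left
      refine ⟨h, ?_⟩
      rw [Nat.div_mod_unique (by omega)]
      exact ⟨by omega, h⟩
    · right
      refine ⟨by omega, ?_⟩
      rw [Nat.div_mod_unique (by omega)]
      refine ⟨?_, by omega⟩
      rw [mul_add]; omega
  let bd : ℕ → ℕ → ℕ → Set ℕ := fun r a c => Set.Ico (lo b pb r a c) (hi nb r a c)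
  have hwrap : ∀ r c, c < n → bd r n c = bd (r + 1) 0 c := by
    intro r c hc
    have e1 : lo b pb r n c = lo b pb (r + 1) 0 c := by
      have := hb c; have := hpb c
      unfold lo
      split_ifs <;> omega
    have e2 : hi nb r n c = hi nb (r + 1) 0 c := by
      have := hnb c
      unfold hi
      split_ifs <;> omega
    simp only [bd, e1, e2]
  have hnext : ∀ t c, c < n → bd ((t + 1) / n) ((t + 1) % n) c = bd (t / n) (t % n + 1) c := by
    intro t c hc
    rcases hdiv t with ⟨-, h1, h2⟩ | ⟨h0, h1, h2⟩
    · rw [h1, h2]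
    · rw [h1, h2, h0, hwrap _ _ hc]
  let g : TokenGame n :=
    { len := n * n
      board := fun t c => bd (t / n) (t % n) c
      active := fun t => ⟨t % n, Nat.mod_lt t hn⟩
      move := fun t => if h : t / n < n ∧ nb (t % n) ≤ t / n ∧ t / n + t % n < 2 * nb (t % n) then
        some (⟨t / n, h.1⟩, 2 * nb (t % n) - t % n - t / n - 1,
          2 * nb (t % n) - t % n - t / n - 1) else none
      active_succ := fun t => by simp
      step_none := by
        intro t ht hm w
        have hr : t / n < n := Nat.div_lt_of_lt_mul ht
        have ha : t % n < n := Nat.mod_lt t hn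
        simp only [dite_eq_right_iff, reduceCtorEq, imp_false] at hm
        rw [hnext t w w.2]
        simp only [Fin.ext_iff]
        generalize t / n = r at *
        generalize t % n = a at *
        have hm' : ¬ (nb a ≤ r ∧ r + a < 2 * nb a) := fun h => hm ⟨hr, h⟩
        have := hb a; have := hnb a; have := hpb a
        split_ifs with hw
        · rw [hw]
          by_cases hra : r < a
          · simp only [bd]
            rw [shiftDown_Ico_pos]
            · congr 1
              · unfold lo; split_ifs <;> omega
              · unfold hi; split_ifs <;> omega
            · unfold lo; split_ifs <;> omega
          · have e1 : lo b pb r a a = 0 := by unfold lo; split_ifs <;> omega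
            have e2 : lo b pb r (a + 1) a = 0 := by unfold lo; split_ifs <;> omega
            have e3 : hi nb r (a + 1) a = hi nb r a a := by unfold hi; split_ifs <;> omega
            simp only [bd]
            rw [e1, e2, e3, shiftDown_Ico_zero]
        · generalize (w : ℕ) = c at *
          have e3 : hi nb r (a + 1) c = hi nb r a c := by unfold hi; split_ifs <;> omega
          have e1 : lo b pb r (a + 1) c = lo b pb r a c := by
            have := hb c; have := hpb c; have := hd1 a c
            unfold lo; split_ifs <;> omega
          simp only [bd, e1, e3]
      step_some := by
        intro t ht v i i' hm
        split_ifs at hm with h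
        simp only [Option.some.injEq, Prod.mk.injEq] at hm
        obtain ⟨rfl, hi1, hi2⟩ := hm
        have ha : t % n < n := Nat.mod_lt t hn
        have huniq : ∀ t', t' / n = t / n → t' % n = t % n → t' = t := by
          intro t' h1 h2
          rw [← Nat.div_add_mod t' n, h1, h2, Nat.div_add_mod]
        simp only [hnext t _ (Fin.is_lt _)]
        have hun2 : ∀ t' < t, ∀ (v' : Fin n) (i₀ i₀' : ℕ),
            (if h : t' / n < n ∧ nb (t' % n) ≤ t' / n ∧ t' / n + t' % n < 2 * nb (t' % n) then
            some ((⟨t' / n, h.1⟩ : Fin n), 2 * nb (t' % n) - t' % n - t' / n - 1,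
            2 * nb (t' % n) - t' % n - t' / n - 1) else none) = some (v', i₀, i₀') →
            ¬((t' % n = t % n ∧ v' = t / n) ∨ (t' % n = t / n ∧ v' = t % n)) := by
          intro t' ht' v' i₀ i₀' hm'
          split_ifs at hm' with h'
          simp only [Option.some.injEq, Prod.mk.injEq] at hm'
          obtain ⟨rfl, -, -⟩ := hm'
          simp only
          have := huniq t'
          have := hnb (t % n); have := hnb (t' % n)
          rintro (⟨h1, h2⟩ | ⟨h1, h2⟩)
          · have := huniq t' h2 h1
            omega
          · omega
        simp only [Fin.ext_iff, ne_eq]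
        refine ⟨?_, ?_, ?_, ?_, ?_, ?_, ?_⟩
        rotate_left 5
        · exact hun2
        all_goals
          clear hun2 huniq
          have := hb (t % n)
          have := hnb (t % n)
          have := hpb (t % n)
          have hrr := hb (t / n)
          have hrn := hnb (t / n)
          have hrs := hsum (t / n)
          obtain ⟨hq1, hq2⟩ := hd2 (t % n) (t / n) h.2.1 h.2.2
          generalize t / n = r at *
          generalize t % n = a at *
        · intro w
          split_ifs with h1 h2
          · rw [h1]
            have e1 : lo b pb r a a = 0 := by unfold lo; split_ifs <;> omega
            have e2 : lo b pb r (a + 1) a = 0 := by unfold lo; split_ifs <;> omega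
            have e3 : hi nb r (a + 1) a = i := by unfold hi; split_ifs <;> omega
            have e4 : hi nb r a a = i + 1 := by unfold hi; split_ifs <;> omega
            simp only [bd]
            have e5 : Set.Ico 0 (i + 1) \ {i} = Set.Ico 0 i := by
              ext j; simp; omega
            rw [e1, e2, e3, e4, e5, shiftDown_Ico_zero]
          · rw [h2]
            have e1 : lo b pb r a r = i' + 1 := by unfold lo; split_ifs <;> omega
            have e2 : lo b pb r (a + 1) r = i' := by unfold lo; split_ifs <;> omega
            have e3 : hi nb r (a + 1) r = hi nb r a r := by unfold hi; split_ifs <;> omega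
            have e4 : i' < hi nb r a r := by unfold hi; split_ifs <;> omega
            simp only [bd]
            rw [e1, e2, e3]
            ext j; simp; omega
          · generalize (w : ℕ) = c at *
            have e1 : lo b pb r (a + 1) c = lo b pb r a c := by
              unfold lo; split_ifs <;> omega
            have e3 : hi nb r (a + 1) c = hi nb r a c := by unfold hi; split_ifs <;> omega
            simp only [bd, e1, e3]
        · omega
        · intro j hj
          have e1 : lo b pb r a a = 0 := by unfold lo; split_ifs <;> omega
          have e4 : hi nb r a a = i + 1 := by unfold hi; split_ifs <;> omega
          simp only [bd, e1, e4, Set.mem_Ico]; omega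
        · have e4 : hi nb r a a = i + 1 := by unfold hi; split_ifs <;> omega
          simp only [bd, e4, Set.mem_Ico]; omega
        · omega
        · have e1 : lo b pb r a r = i' + 1 := by unfold lo; split_ifs <;> omega
          simp only [bd, e1, Set.mem_Ico]; omega }
  have hmain := le_ghat (s := s) g (fun u => Set.finite_Ico _ _) (fun u => by
      change (Set.Ico (lo b pb (0 / n) (0 % n) u) (hi nb (0 / n) (0 % n) u)).ncard ≤ s
      have := hb u; have := hnb u; have := hpb u; have := hsum u
      rw [← Finset.coe_Ico, Set.ncard_coe_finset, Nat.card_Ico, Nat.zero_div, Nat.zero_mod]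
      unfold lo hi; split_ifs <;> omega)
    ((stageStart s k + 1) * n) (Nat.mul_le_mul_right n hk) ⟨stageStart s k, hk⟩
  refine le_trans ?_ hmain
  change _ ≤ (Set.Ico (lo b pb (((stageStart s k + 1) * n) / n) (((stageStart s k + 1) * n) % n)
    (stageStart s k)) (hi nb (((stageStart s k + 1) * n) / n) (((stageStart s k + 1) * n) % n)
    (stageStart s k))).ncard
  rw [Nat.mul_div_cancel _ hn, Nat.mul_mod_left,
    ← Finset.coe_Ico, Set.ncard_coe_finset, Nat.card_Ico]
  have h1 := hst k
  have h2 : stageStart s (k + 1) = stageStart s k + s * (k + 1) := rfl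
  have h3 : 0 < s * (k + 1) := Nat.mul_pos hs (by omega)
  unfold lo hi; split_ifs <;> omega

/-- Theorem `tglower` of the paper.
`ĝ(n,s) ≥ max{s, √(2ns) − 3s/2}` for all positive integers `n` and `s`. -/
theorem ghat_lower_bound (n s : ℕ) (hn : 1 ≤ n) (hs : 1 ≤ s) :
    max (s : ℝ) (Real.sqrt (2 * n * s) - 3 * s / 2) ≤ (ghat n s : ℝ) := by
  apply max_le
  · have := main_bound n s hn hs 0 (by simp only [stageStart]; omega)
    exact_mod_cast (by simpa using this)
  · obtain ⟨m, h1, h2⟩ := exists_stage s hs n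
    have hm : s * m ≤ ghat n s := by
      rcases m with _ | k
      · simp
      · apply main_bound n s hn hs k
        have : 0 < s * (k + 1) := Nat.mul_pos hs (by omega)
        simp only [stageStart] at h1
        omega
    have h3 : 2 * n ≤ s * ((m + 1) * (m + 2)) := by
      have := two_stageStart s (m + 1)
      rw [show m + 1 + 1 = m + 2 from rfl] at this
      omega
    have h3' : (2 * n : ℝ) ≤ s * ((m + 1) * (m + 2)) := by exact_mod_cast h3
    have hm' : (s * m : ℝ) ≤ ghat n s := by exact_mod_cast hm
    have h4 : Real.sqrt (2 * n * s) ≤ s * (m + 3 / 2) := by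
      apply Real.sqrt_le_iff.2
      refine ⟨by positivity, ?_⟩
      have := mul_le_mul_of_nonneg_right h3' (Nat.cast_nonneg (α := ℝ) s)
      nlinarith [sq_nonneg (s : ℝ)]
    linarith

end AltitudePaper
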